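/- arXiv:2106.11925 — 3 statements merged into one kernel-verified Lean document; each statement's English description precedes it below -/
import Mathlib

section
/- For every z ≥ 0 and y ∈ ℝ³, the point v = X(z,y) satisfies c₁ (χ₀ + R_* z)^{-1} |y| (1+|y|)^{-a} ≤ |v| ≤ c₂ (χ₀ + R_* z)^{a} |y| (1+|y|)^{-a}, where c₁ = min{1, χ₀}^a and c₂ = 2^a c₁^{-1} min{a₀, a_N}^{-1}. Moreover, (χ₀ + R_* z)^{-(1-a)} |y|^{1-a} − 1 ≤ |v| ≤ c₃ |y|^{1-a}, where c₃ = a_N^{a-1}. -/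
open Real

noncomputable section

abbrev E3 := EuclideanSpace ℝ (Fin 3)

/-- The cross product `x × y` in `ℝ³`. -/
def cross3 (x y : E3) : E3 :=
  (WithLp.equiv 2 (Fin 3 → ℝ)).symm
    ![x 1 * y 2 - x 2 * y 1, x 2 * y 0 - x 0 * y 2, x 0 * y 1 - x 1 * y 0]

/-- The function `g(s) = Σ aᵢ s^{ᾱᵢ}` (with `0⁰ = 1`, as for `Real.rpow`). -/
def gFun (N : ℕ) (α' A : Fin (N + 1) → ℝ) (s : ℝ) : ℝ := ∑ i, A i * s ^ α' i

theorem inner_cross3_right_self (x y : E3) : inner ℝ y (cross3 x y) = 0 := by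
  simp [cross3, PiLp.inner_apply, Fin.sum_univ_three]
  ring

theorem norm_cross3_le (x y : E3) : ‖cross3 x y‖ ≤ ‖x‖ * ‖y‖ := by
  refine (sq_le_sq₀ (norm_nonneg _) (by positivity)).1 ?_
  rw [mul_pow, EuclideanSpace.real_norm_sq_eq, EuclideanSpace.real_norm_sq_eq,
    EuclideanSpace.real_norm_sq_eq]
  simp only [cross3, Fin.sum_univ_three, WithLp.equiv_symm_apply, Matrix.cons_val]
  nlinarith [sq_nonneg (x 0 * y 0 + x 1 * y 1 + x 2 * y 2)]

/-- If `w` is orthogonal to `v`, then adding `w` to `c • v` does not decrease the norm. -/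
theorem mul_norm_le_norm_smul_add {v w : E3} (h : inner ℝ v w = 0) (c : ℝ) :
    c * ‖v‖ ≤ ‖c • v + w‖ := by
  rcases (norm_nonneg v).eq_or_lt with hv | hv
  · rw [← hv, mul_zero]
    positivity
  · have h₁ : inner ℝ v (c • v + w) = c * ‖v‖ ^ 2 := by
      rw [inner_add_right, inner_smul_right, h, real_inner_self_eq_norm_sq, add_zero]
    have h₂ := real_inner_le_norm v (c • v + w)
    rw [h₁] at h₂
    nlinarith

section gFun

variable {N : ℕ} {α' A : Fin (N + 1) → ℝ}

theorem mul_rpow_le_gFun (hA : ∀ i, 0 < A i) {s : ℝ} (hs : 0 ≤ s) (i : Fin (N + 1)) :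
    A i * s ^ α' i ≤ gFun N α' A s :=
  Finset.single_le_sum (f := fun i => A i * s ^ α' i)
    (fun j _ => mul_nonneg (hA j).le (rpow_nonneg hs _)) (Finset.mem_univ i)

theorem gFun_le_sum (hα : ∀ i, 0 ≤ α' i) (hA : ∀ i, 0 < A i) {s : ℝ} (hs : 0 ≤ s)
    (hs1 : s ≤ 1) : gFun N α' A s ≤ ∑ i, A i :=
  Finset.sum_le_sum fun i _ =>
    mul_le_of_le_one_right (hA i).le (rpow_le_one hs hs1 (hα i))

theorem gFun_le_sum_mul_rpow (hα : Monotone α') (hA : ∀ i, 0 < A i) {s : ℝ} (hs : 1 ≤ s) :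
    gFun N α' A s ≤ (∑ i, A i) * s ^ α' (Fin.last N) := by
  rw [Finset.sum_mul]
  exact Finset.sum_le_sum fun i _ => mul_le_mul_of_nonneg_left
    (rpow_le_rpow_of_exponent_le hs (hα (Fin.le_last i))) (hA i).le

end gFun

section Growth

variable {α a s r M χ : ℝ}

theorem rpow_one_add_rpow_one_sub (hα : 0 < α) (ha : a = α / (1 + α)) (hs : 0 ≤ s) :
    (s ^ (1 + α)) ^ (1 - a) = s := by
  have h : (1 + α) * (1 - a) = 1 := by
    rw [ha]
    field_simp
    ring
  rw [← rpow_mul hs, h, rpow_one]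

theorem rpow_one_add_rpow (hα : 0 < α) (ha : a = α / (1 + α)) (hs : 0 ≤ s) :
    (s ^ (1 + α)) ^ a = s ^ α := by
  have h : (1 + α) * a = α := by
    rw [ha]
    field_simp
  rw [← rpow_mul hs, h]

theorem le_rpow_mul_rpow_of_mul_rpow_le (hα : 0 < α) (ha : a = α / (1 + α)) (ha1 : a < 1)
    (hs : 0 ≤ s) {b : ℝ} (hb : 0 < b) (h : b * s ^ (1 + α) ≤ r) :
    s ≤ b ^ (a - 1) * r ^ (1 - a) := by
  have h₁ : b ^ (1 - a) * s ≤ r ^ (1 - a) := by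
    calc b ^ (1 - a) * s = (b * s ^ (1 + α)) ^ (1 - a) := by
          rw [mul_rpow hb.le (by positivity), rpow_one_add_rpow_one_sub hα ha hs]
      _ ≤ r ^ (1 - a) := rpow_le_rpow (by positivity) h (by linarith)
  have h₂ : b ^ (a - 1) * b ^ (1 - a) = 1 := by
    rw [← rpow_add hb]
    simp
  calc s = b ^ (a - 1) * (b ^ (1 - a) * s) := by rw [← mul_assoc, h₂, one_mul]
    _ ≤ b ^ (a - 1) * r ^ (1 - a) := by gcongr

theorem rpow_le_of_le_mul_rpow (hα : 0 < α) (ha : a = α / (1 + α)) (ha1 : a < 1)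
    (hs : 0 ≤ s) (hr : 0 ≤ r) (hM : 0 < M) (h : r ≤ M * s ^ (1 + α)) :
    r ^ (1 - a) ≤ M ^ (1 - a) * s := by
  calc r ^ (1 - a) ≤ (M * s ^ (1 + α)) ^ (1 - a) := rpow_le_rpow hr h (by linarith)
    _ = M ^ (1 - a) * s := by
      rw [mul_rpow hM.le (by positivity), rpow_one_add_rpow_one_sub hα ha hs]

theorem rpow_neg_mul_rpow_sub_one_le (hα : 0 < α) (ha : a = α / (1 + α)) (ha1 : a < 1)
    (hs : 0 ≤ s) (hr : 0 ≤ r) (hM : 0 < M) (hsmall : s ≤ 1 → r ≤ M * s)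
    (hlarge : 1 ≤ s → r ≤ M * s ^ (1 + α)) :
    M ^ (-(1 - a)) * r ^ (1 - a) - 1 ≤ s := by
  have h₁ : r ^ (1 - a) ≤ M ^ (1 - a) * (1 + s) := by
    rcases le_total s 1 with h | h
    · calc r ^ (1 - a) ≤ M ^ (1 - a) :=
            rpow_le_rpow hr (by nlinarith [hsmall h]) (by linarith)
        _ ≤ M ^ (1 - a) * (1 + s) := le_mul_of_one_le_right (by positivity) (by linarith)
    · refine (rpow_le_of_le_mul_rpow hα ha ha1 hs hr hM (hlarge h)).trans ?_
      gcongr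
      linarith
  rw [rpow_neg hM.le, sub_le_iff_le_add', inv_mul_le_iff₀ (by positivity)]
  exact h₁

theorem min_rpow_mul_le (hα : 0 < α) (ha : a = α / (1 + α)) (ha0 : 0 < a) (ha1 : a < 1)
    (hs : 0 ≤ s) (hr : 0 ≤ r) (hχ : 0 < χ) (hχM : χ ≤ M) (hsmall : s ≤ 1 → r ≤ M * s)
    (hlarge : 1 ≤ s → r ≤ M * s ^ (1 + α)) :
    (min 1 χ) ^ a * M ^ (-1 : ℝ) * r * (1 + r) ^ (-a) ≤ s := by
  have hM : 0 < M := hχ.trans_le hχM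
  have hm : 0 < min 1 χ := lt_min one_pos hχ
  rw [rpow_neg_one, rpow_neg (by linarith)]
  have h₁ : (min 1 χ) ^ a * r ≤ M * s * (1 + r) ^ a := by
    rcases le_total s 1 with h | h
    · have h₂ : (min 1 χ) ^ a ≤ 1 := rpow_le_one hm.le (min_le_left _ _) ha0.le
      have h₃ : 1 ≤ (1 + r) ^ a := one_le_rpow (by linarith) ha0.le
      calc (min 1 χ) ^ a * r ≤ 1 * r := by gcongr
        _ ≤ M * s * 1 := by linarith [hsmall h]
        _ ≤ M * s * (1 + r) ^ a := by gcongr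
    · have h₂ : (min 1 χ) ^ a ≤ M ^ a :=
        rpow_le_rpow hm.le ((min_le_right _ _).trans hχM) ha0.le
      have h₃ : r = r ^ (1 - a) * r ^ a := by
        rw [← rpow_add' hr (by simp), sub_add_cancel, rpow_one]
      have h₄ : M ^ a * M ^ (1 - a) = M := by
        rw [← rpow_add hM, add_sub_cancel, rpow_one]
      calc (min 1 χ) ^ a * r = (min 1 χ) ^ a * (r ^ (1 - a) * r ^ a) := by rw [← h₃]
        _ ≤ M ^ a * (M ^ (1 - a) * s * (1 + r) ^ a) := by
          gcongr
          · exact rpow_le_of_le_mul_rpow hα ha ha1 hs hr hM (hlarge h)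
          · linarith
        _ = M * s * (1 + r) ^ a := by rw [← mul_assoc, ← mul_assoc, h₄]
  have hp : 0 < (1 + r) ^ a := by positivity
  calc (min 1 χ) ^ a * M⁻¹ * r * ((1 + r) ^ a)⁻¹
      = ((min 1 χ) ^ a * r) * (M * (1 + r) ^ a)⁻¹ := by
        rw [mul_inv]
        ring
    _ ≤ s := by
      rw [mul_inv_le_iff₀ (by positivity)]
      linarith

theorem le_mul_rpow_mul_one_add_rpow (hα : 0 < α) (ha : a = α / (1 + α)) (ha0 : 0 < a)
    (hs : 0 ≤ s) (hr : 0 ≤ r) (hχ : 0 < χ) (hχM : χ ≤ M) (hsmall : s ≤ 1 → r ≤ M * s)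
    (hlarge : 1 ≤ s → r ≤ M * s ^ (1 + α)) {b b' : ℝ} (hb : 0 < b) (hb' : 0 < b')
    (hlin : b * s ≤ r) (hpow : b' * s ^ α * s ≤ r) :
    s ≤ 2 ^ a * ((min 1 χ) ^ a)⁻¹ * (min b b')⁻¹ * M ^ a * r * (1 + r) ^ (-a) := by
  have hM : 0 < M := hχ.trans_le hχM
  have hm : 0 < min 1 χ := lt_min one_pos hχ
  have hn : 0 < min b b' := lt_min hb hb'
  have ht : 0 < max 1 s := lt_max_of_lt_left one_pos
  have h₁ : min b b' * (s * max 1 s ^ α) ≤ r := by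
    rcases le_total s 1 with h | h
    · rw [max_eq_left h, one_rpow, mul_one]
      exact (mul_le_mul_of_nonneg_right (min_le_left _ _) hs).trans hlin
    · rw [max_eq_right h, mul_comm s, ← mul_assoc]
      refine le_trans ?_ hpow
      gcongr
      exact min_le_right _ _
  have h₂ : r ≤ M * max 1 s ^ (1 + α) := by
    rcases le_total s 1 with h | h
    · rw [max_eq_left h, one_rpow]
      nlinarith [hsmall h]
    · rw [max_eq_right h]
      exact hlarge h
  have h₃ : min 1 χ * (1 + r) ≤ 2 * M * max 1 s ^ (1 + α) := by
    have h₄ : 1 ≤ max 1 s ^ (1 + α) := one_le_rpow (le_max_left _ _) (by linarith)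
    have h₅ : min 1 χ * r ≤ r := mul_le_of_le_one_left hr (min_le_left _ _)
    have h₆ : min 1 χ ≤ M := (min_le_right _ _).trans hχM
    nlinarith
  have h₇ : (min 1 χ) ^ a * (1 + r) ^ a ≤ 2 ^ a * M ^ a * max 1 s ^ α := by
    rw [← rpow_one_add_rpow hα ha ht.le, ← mul_rpow hm.le (by linarith),
      ← mul_rpow zero_le_two hM.le, ← mul_rpow (by positivity) (by positivity)]
    exact rpow_le_rpow (by positivity) h₃ ha0.le
  have hp : 0 < (1 + r) ^ a := by positivity
  have hmp : 0 < (min 1 χ) ^ a := by positivity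
  have h₈ : s * ((min 1 χ) ^ a * min b b' * (1 + r) ^ a) ≤ 2 ^ a * M ^ a * r := by
    calc s * ((min 1 χ) ^ a * min b b' * (1 + r) ^ a)
        = s * min b b' * ((min 1 χ) ^ a * (1 + r) ^ a) := by ring
      _ ≤ s * min b b' * (2 ^ a * M ^ a * max 1 s ^ α) := by gcongr
      _ = 2 ^ a * M ^ a * (min b b' * (s * max 1 s ^ α)) := by ring
      _ ≤ 2 ^ a * M ^ a * r := by gcongr
  rw [rpow_neg (by linarith)]
  calc s ≤ 2 ^ a * M ^ a * r * ((min 1 χ) ^ a * min b b' * (1 + r) ^ a)⁻¹ := by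
        rwa [le_mul_inv_iff₀ (by positivity)]
    _ = _ := by
      rw [mul_inv, mul_inv]
      ring

end Growth

theorem stmt0
    (N : ℕ) (hN : 1 ≤ N)
    (α' : Fin (N + 1) → ℝ) (hα0 : α' 0 = 0) (hαmono : StrictMono α')
    (A : Fin (N + 1) → ℝ) (hA : ∀ i, 0 < A i)
    (k : E3) (hk : ‖k‖ = 1)
    (Rs : ℝ) (hRs : 0 ≤ Rs)
    (X : ℝ → E3 → E3)
    (hX : ∀ z y, gFun N α' A ‖X z y‖ • X z y + (Rs * z) • cross3 k (X z y) = y)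
    (a χ₀ c₁ c₂ c₃ : ℝ)
    (ha : a = α' (Fin.last N) / (1 + α' (Fin.last N)))
    (hχ₀ : χ₀ = ∑ i, A i)
    (hc₁ : c₁ = (min 1 χ₀) ^ a)
    (hc₂ : c₂ = 2 ^ a * c₁⁻¹ * (min (A 0) (A (Fin.last N)))⁻¹)
    (hc₃ : c₃ = (A (Fin.last N)) ^ (a - 1))
    (z : ℝ) (hz : 0 ≤ z) (y : E3) :
    (c₁ * (χ₀ + Rs * z) ^ (-1 : ℝ) * ‖y‖ * (1 + ‖y‖) ^ (-a) ≤ ‖X z y‖ ∧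
      ‖X z y‖ ≤ c₂ * (χ₀ + Rs * z) ^ a * ‖y‖ * (1 + ‖y‖) ^ (-a)) ∧
    ((χ₀ + Rs * z) ^ (-(1 - a)) * ‖y‖ ^ (1 - a) - 1 ≤ ‖X z y‖ ∧
      ‖X z y‖ ≤ c₃ * ‖y‖ ^ (1 - a)) := by
  set v := X z y
  have hv : gFun N α' A ‖v‖ • v + (Rs * z) • cross3 k v = y := hX z y
  have hs : 0 ≤ ‖v‖ := norm_nonneg v
  have hw : 0 ≤ Rs * z := mul_nonneg hRs hz
  have hα : 0 < α' (Fin.last N) := hα0 ▸ hαmono (Fin.lt_def.2 (by simpa using Nat.pos_of_ne_zero (by lia)))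
  have hαnn : ∀ i, 0 ≤ α' i := fun i => hα0 ▸ hαmono.monotone (Fin.zero_le i)
  have ha0 : 0 < a := by
    rw [ha]
    positivity
  have ha1 : a < 1 := by
    rw [ha, div_lt_one (by linarith)]
    linarith
  have hχ : 0 < χ₀ := hχ₀ ▸ Finset.sum_pos (fun i _ => hA i) Finset.univ_nonempty
  have hχM : χ₀ ≤ χ₀ + Rs * z := by linarith
  have hg : 0 ≤ gFun N α' A ‖v‖ :=
    Finset.sum_nonneg fun i _ => mul_nonneg (hA i).le (rpow_nonneg hs _)
  have hlower : gFun N α' A ‖v‖ * ‖v‖ ≤ ‖y‖ := by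
    rw [← hv]
    refine mul_norm_le_norm_smul_add ?_ _
    rw [inner_smul_right, inner_cross3_right_self, mul_zero]
  have hupper : ‖y‖ ≤ (gFun N α' A ‖v‖ + Rs * z) * ‖v‖ := by
    calc ‖y‖ ≤ ‖gFun N α' A ‖v‖ • v‖ + ‖(Rs * z) • cross3 k v‖ := hv ▸ norm_add_le _ _
      _ = gFun N α' A ‖v‖ * ‖v‖ + Rs * z * ‖cross3 k v‖ := by
        rw [norm_smul_of_nonneg hg, norm_smul_of_nonneg hw]
      _ ≤ gFun N α' A ‖v‖ * ‖v‖ + Rs * z * (‖k‖ * ‖v‖) := by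
        gcongr
        exact norm_cross3_le k v
      _ = _ := by
        rw [hk]
        ring
  have hterm : ∀ i, A i * ‖v‖ ^ α' i * ‖v‖ ≤ ‖y‖ := fun i =>
    (mul_le_mul_of_nonneg_right (mul_rpow_le_gFun hA hs i) hs).trans hlower
  have hlin : A 0 * ‖v‖ ≤ ‖y‖ := by simpa [hα0] using hterm 0
  have hsmall : ‖v‖ ≤ 1 → ‖y‖ ≤ (χ₀ + Rs * z) * ‖v‖ := fun h => by
    refine hupper.trans ?_
    gcongr
    exact hχ₀ ▸ gFun_le_sum hαnn hA hs h
  have hlarge : 1 ≤ ‖v‖ → ‖y‖ ≤ (χ₀ + Rs * z) * ‖v‖ ^ (1 + α' (Fin.last N)) := fun h => by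
    have h₁ : gFun N α' A ‖v‖ ≤ χ₀ * ‖v‖ ^ α' (Fin.last N) :=
      hχ₀ ▸ gFun_le_sum_mul_rpow hαmono.monotone hA h
    have h₂ : Rs * z ≤ Rs * z * ‖v‖ ^ α' (Fin.last N) :=
      le_mul_of_one_le_right hw (one_le_rpow h hα.le)
    rw [rpow_add (by linarith), rpow_one, mul_comm ‖v‖, ← mul_assoc]
    refine hupper.trans (mul_le_mul_of_nonneg_right ?_ hs)
    linarith
  have hpow : A (Fin.last N) * ‖v‖ ^ (1 + α' (Fin.last N)) ≤ ‖y‖ := by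
    rw [rpow_add' hs (by linarith), rpow_one, mul_comm ‖v‖, ← mul_assoc]
    exact hterm _
  rw [hc₂, hc₁, hc₃]
  exact ⟨⟨min_rpow_mul_le hα ha ha0 ha1 hs (norm_nonneg y) hχ hχM hsmall hlarge,
    le_mul_rpow_mul_one_add_rpow hα ha ha0 hs (norm_nonneg y) hχ hχM hsmall hlarge
      (hA 0) (hA _) hlin (hterm _)⟩,
    rpow_neg_mul_rpow_sub_one_le hα ha ha1 hs (norm_nonneg y) (hχ.trans_le hχM) hsmall hlarge,
    le_rpow_mul_rpow_of_mul_rpow_le hα ha ha1 hs (hA _) hpow⟩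
end
end

section
/- For every z ≥ 0 and y ∈ ℝ³: c₄ (χ₀ + R_* z)^{-2} |y|² (1+|y|)^{-a} ≤ X(z,y)·y ≤ c₂ (χ₀ + R_* z)^{a} |y|² (1+|y|)^{-a}, where c₄ = (min{1, a₀, a_N}/2^{ᾱ_N})^{1+a} and c₂ = 2^a min{1, χ₀}^{-a} min{a₀, a_N}^{-1}. Moreover, c₅ (χ₀ + R_* z)^{-2} (|y|^{2-a} − 1) ≤ X(z,y)·y ≤ c₃ |y|^{2-a}, where c₅ = 2^{-a} c₄ and c₃ = a_N^{a-1}. -/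
open Real
open scoped RealInnerProductSpace

noncomputable section

theorem inner_cross3_self (k v : E3) : ⟪v, cross3 k v⟫ = 0 := by
  simp [cross3, PiLp.inner_apply, Fin.sum_univ_three]
  ring

theorem norm_cross3_sq_le (k v : E3) : ‖cross3 k v‖ ^ 2 ≤ ‖k‖ ^ 2 * ‖v‖ ^ 2 := by
  simp only [EuclideanSpace.real_norm_sq_eq, Fin.sum_univ_three, cross3]
  simp
  nlinarith [sq_nonneg (k 0 * v 0 + k 1 * v 1 + k 2 * v 2)]

theorem inner_smul_add_cross3 (k v : E3) (g w : ℝ) :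
    ⟪v, g • v + w • cross3 k v⟫ = g * ‖v‖ ^ 2 := by
  rw [inner_add_right, real_inner_smul_right, real_inner_smul_right, inner_cross3_self,
    real_inner_self_eq_norm_sq]
  ring

theorem norm_smul_add_cross3_sq (k v : E3) (g w : ℝ) :
    ‖g • v + w • cross3 k v‖ ^ 2 = g ^ 2 * ‖v‖ ^ 2 + w ^ 2 * ‖cross3 k v‖ ^ 2 := by
  rw [norm_add_sq_real, real_inner_smul_left, real_inner_smul_right, inner_cross3_self,
    norm_smul, norm_smul, mul_pow, mul_pow, Real.norm_eq_abs, Real.norm_eq_abs, sq_abs, sq_abs]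
  ring

section gFun

variable {N : ℕ} {α' A : Fin (N + 1) → ℝ} {s : ℝ}

theorem coeff_mul_rpow_le_gFun (hA : ∀ i, 0 < A i) (hs : 0 ≤ s) (i : Fin (N + 1)) :
    A i * s ^ α' i ≤ gFun N α' A s :=
  Finset.single_le_sum (f := fun i => A i * s ^ α' i)
    (fun j _ => mul_nonneg (hA j).le (rpow_nonneg hs _)) (Finset.mem_univ i)

theorem gFun_le (hα0 : α' 0 = 0) (hα : StrictMono α') (hA : ∀ i, 0 < A i) (hs : 0 ≤ s) :
    gFun N α' A s ≤ (∑ i, A i) * max 1 s ^ α' (Fin.last N) := by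
  rw [gFun, Finset.sum_mul]
  refine Finset.sum_le_sum fun i _ => mul_le_mul_of_nonneg_left ?_ (hA i).le
  have hi : 0 ≤ α' i := hα0 ▸ hα.monotone (Fin.zero_le i)
  exact (rpow_le_rpow hs (le_max_right _ _) hi).trans
    (rpow_le_rpow_of_exponent_le (le_max_left _ _) (hα.monotone (Fin.le_last i)))

theorem le_gFun (hα0 : α' 0 = 0) (hA : ∀ i, 0 < A i) (hs : 0 ≤ s) :
    min (A 0) (A (Fin.last N)) * max 1 s ^ α' (Fin.last N) ≤ gFun N α' A s := by
  rcases le_total s 1 with h | h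
  · rw [max_eq_left h, one_rpow, mul_one]
    have := coeff_mul_rpow_le_gFun (α' := α') hA hs 0
    rw [hα0, rpow_zero, mul_one] at this
    exact (min_le_left _ _).trans this
  · rw [max_eq_right h]
    exact (mul_le_mul_of_nonneg_right (min_le_right _ _) (rpow_nonneg hs _)).trans
      (coeff_mul_rpow_le_gFun hA hs _)

end gFun

section Scalar

variable {r ρ g w α a χ b : ℝ}

/-- The exponent `a = α / (1 + α)` satisfies `(1 + α) * a = α`. -/
theorem rpow_one_add_rpow_s1 {R : ℝ} (hR : 0 ≤ R) (haα : (1 + α) * a = α) :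
    (R ^ (1 + α)) ^ a = R ^ α := by
  rw [← rpow_mul hR, haα]

theorem le_sum_mul_of_sq_le (hr : 0 ≤ r) (hg : 0 ≤ g) (hw : 0 ≤ w)
    (h : ρ ^ 2 ≤ (g ^ 2 + w ^ 2) * r ^ 2) : ρ ≤ (g + w) * r := by
  refine (abs_le_of_sq_le_sq' (h.trans ?_) (by positivity)).2
  rw [mul_pow]
  gcongr
  nlinarith [mul_nonneg hg hw]

theorem mul_sq_le_of_le_rpow (ha0 : 0 ≤ a) (hα : 0 < α) (haα : (1 + α) * a = α)
    (hb : 0 < b) (hχ : 0 < χ) (hw : 0 ≤ w) (hr : 0 ≤ r) (hρ : 0 ≤ ρ)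
    (hlow : b * max 1 r ^ α ≤ g) (hup : g ≤ χ * max 1 r ^ α)
    (hgρ : g * r ≤ ρ) (hρg : ρ ^ 2 ≤ (g ^ 2 + w ^ 2) * r ^ 2) :
    g * r ^ 2 ≤ 2 ^ a * min 1 χ ^ (-a) * b⁻¹ * (χ + w) ^ a * ρ ^ 2 * (1 + ρ) ^ (-a) := by
  have hR1 : 1 ≤ max 1 r := le_max_left _ _
  have hR0 : 0 < max 1 r := one_pos.trans_le hR1
  set R := max 1 r with hR
  have hRα : 1 ≤ R ^ α := one_le_rpow hR1 hα.le
  have hg : 0 < g := (by positivity : 0 < b * R ^ α).trans_le hlow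
  have hm : 0 < min 1 χ := lt_min one_pos hχ
  have hR' : R ^ (1 + α) = R ^ α * R := by rw [add_comm, rpow_add_one hR0.ne']
  have hρR : ρ ≤ (χ + w) * R ^ (1 + α) := by
    refine (le_sum_mul_of_sq_le hr hg.le hw hρg).trans ?_
    rw [hR', ← mul_assoc]
    refine mul_le_mul ?_ (le_max_right _ _) hr (by positivity)
    nlinarith
  have hR1' : 1 ≤ R ^ (1 + α) := one_le_rpow hR1 (by positivity)
  have h1 : min 1 χ * (1 + ρ) ≤ 2 * (χ + w) * R ^ (1 + α) := by
    have e1 : min 1 χ ≤ χ + w := (min_le_right _ _).trans (by linarith)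
    have e2 : min 1 χ * ρ ≤ ρ := mul_le_of_le_one_left hρ (min_le_left _ _)
    have e3 : χ + w ≤ (χ + w) * R ^ (1 + α) := le_mul_of_one_le_right (by positivity) hR1'
    linarith
  have h2 : min 1 χ ^ a * (1 + ρ) ^ a ≤ 2 ^ a * (χ + w) ^ a * R ^ α := by
    have := rpow_le_rpow (by positivity) h1 ha0
    rwa [mul_rpow hm.le (by positivity), mul_rpow (by positivity) (by positivity),
      mul_rpow (by positivity) (by positivity), rpow_one_add_rpow_s1 hR0.le haα] at this
  have h3 : b * (min 1 χ ^ a * (1 + ρ) ^ a) ≤ 2 ^ a * (χ + w) ^ a * g :=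
    calc b * (min 1 χ ^ a * (1 + ρ) ^ a) ≤ b * (2 ^ a * (χ + w) ^ a * R ^ α) := by gcongr
      _ = 2 ^ a * (χ + w) ^ a * (b * R ^ α) := by ring
      _ ≤ _ := by gcongr
  have h4 : (g * r) ^ 2 ≤ ρ ^ 2 := by gcongr
  rw [rpow_neg hm.le, rpow_neg (by positivity)]
  have hM : 0 < min 1 χ ^ a := by positivity
  have hP : 0 < (1 + ρ) ^ a := by positivity
  have h5 : 2 ^ a * (min 1 χ ^ a)⁻¹ * b⁻¹ * (χ + w) ^ a * ρ ^ 2 * ((1 + ρ) ^ a)⁻¹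
      = 2 ^ a * (χ + w) ^ a * ρ ^ 2 / (b * (min 1 χ ^ a * (1 + ρ) ^ a)) := by
    field_simp
  rw [h5, le_div_iff₀ (by positivity)]
  calc g * r ^ 2 * (b * (min 1 χ ^ a * (1 + ρ) ^ a))
      ≤ g * r ^ 2 * (2 ^ a * (χ + w) ^ a * g) := by gcongr
    _ = 2 ^ a * (χ + w) ^ a * (g * r) ^ 2 := by ring
    _ ≤ _ := by gcongr

theorem le_mul_sq_of_le_rpow (ha0 : 0 ≤ a) (hα : 0 < α) (haα : (1 + α) * a = α)
    (hb : 0 < b) (hχ : 0 < χ) (hw : 0 ≤ w) (hρ : 0 ≤ ρ)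
    (hlow : b * max 1 r ^ α ≤ g) (hup : g ≤ χ * max 1 r ^ α)
    (hgρ : g * r ≤ ρ) (hρg : ρ ^ 2 ≤ (g ^ 2 + w ^ 2) * r ^ 2) :
    (min 1 b / 2 ^ α) ^ (1 + a) * ((χ + w) ^ 2)⁻¹ * ρ ^ 2 * (1 + ρ) ^ (-a) ≤ g * r ^ 2 := by
  have hR1 : 1 ≤ max 1 r := le_max_left _ _
  have hR0 : 0 < max 1 r := one_pos.trans_le hR1
  set R := max 1 r with hR
  have hRα : 1 ≤ R ^ α := one_le_rpow hR1 hα.le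
  have hg : 0 < g := (by positivity : 0 < b * R ^ α).trans_le hlow
  have hm : 0 < min 1 b := lt_min one_pos hb
  set m := min 1 b with hmdef
  have hlow' : m * R ^ α ≤ g :=
    (mul_le_mul_of_nonneg_right (min_le_right _ _) (by positivity)).trans hlow
  have hR' : R ^ (1 + α) = R ^ α * R := by rw [add_comm, rpow_add_one hR0.ne']
  have h1 : m * R ^ (1 + α) ≤ 1 + ρ := by
    rcases le_total r 1 with h | h
    · rw [hR, max_eq_left h, one_rpow, mul_one]
      linarith [min_le_left 1 b]
    · have : R = r := max_eq_right h
      rw [hR', this, ← mul_assoc, ← this]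
      have : m * R ^ α * R ≤ g * R := by gcongr
      rw [‹R = r›] at this ⊢
      linarith
  have h2 : m ^ a * R ^ α ≤ (1 + ρ) ^ a := by
    have := rpow_le_rpow (by positivity) h1 ha0
    rwa [mul_rpow hm.le (by positivity), rpow_one_add_rpow_s1 hR0.le haα] at this
  have h3 : m ^ (1 + a) * (R ^ α) ^ 2 ≤ (1 + ρ) ^ a * g := by
    rw [add_comm, rpow_add_one hm.ne']
    calc m ^ a * m * (R ^ α) ^ 2 = (m ^ a * R ^ α) * (m * R ^ α) := by ring
      _ ≤ _ := by gcongr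
  have h4 : g ^ 2 + w ^ 2 ≤ (χ + w) ^ 2 * (R ^ α) ^ 2 := by
    have e : g + w ≤ (χ + w) * R ^ α := by nlinarith
    calc g ^ 2 + w ^ 2 ≤ (g + w) ^ 2 := by nlinarith [mul_nonneg hg.le hw]
      _ ≤ ((χ + w) * R ^ α) ^ 2 := by gcongr
      _ = _ := by ring
  have h5 : (m / 2 ^ α) ^ (1 + a) ≤ m ^ (1 + a) := by
    refine rpow_le_rpow (by positivity) ?_ (by positivity)
    exact div_le_self hm.le (one_le_rpow (by norm_num) hα.le)
  rw [rpow_neg (by positivity), ← div_eq_mul_inv, ← div_eq_mul_inv,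
    div_le_iff₀ (by positivity), div_mul_eq_mul_div, div_le_iff₀ (by positivity)]
  calc (m / 2 ^ α) ^ (1 + a) * ρ ^ 2
      ≤ m ^ (1 + a) * ((χ + w) ^ 2 * (R ^ α) ^ 2 * r ^ 2) := by
        gcongr
        exact hρg.trans (by gcongr)
    _ = (m ^ (1 + a) * (R ^ α) ^ 2) * ((χ + w) ^ 2 * r ^ 2) := by ring
    _ ≤ ((1 + ρ) ^ a * g) * ((χ + w) ^ 2 * r ^ 2) := by gcongr
    _ = _ := by ring

theorem mul_sq_le_rpow {q : ℝ} (ha1 : a ≤ 1) (haα : (1 + α) * a = α) (hq : 0 < q)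
    (hr : 0 ≤ r) (hρ : 0 ≤ ρ) (hlow : q * r ^ α ≤ g) (hgρ : g * r ≤ ρ) :
    g * r ^ 2 ≤ q ^ (a - 1) * ρ ^ (2 - a) := by
  rcases hr.eq_or_lt with rfl | hr
  · simp only [ne_eq, OfNat.ofNat_ne_zero, not_false_eq_true, zero_pow, mul_zero]
    positivity
  have hg : 0 < g := (by positivity : 0 < q * r ^ α).trans_le hlow
  have h1 : g ^ (a - 1) * r ^ a ≤ q ^ (a - 1) := by
    have := rpow_le_rpow_of_nonpos (by positivity) hlow (by linarith : a - 1 ≤ 0)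
    rw [mul_rpow hq.le (by positivity), ← rpow_mul hr.le,
      (by linarith : α * (a - 1) = -a), rpow_neg hr.le, ← div_eq_mul_inv,
      le_div_iff₀ (by positivity)] at this
    exact this
  have h2 : (g * r) ^ (2 - a) ≤ ρ ^ (2 - a) :=
    rpow_le_rpow (by positivity) hgρ (by linarith)
  have h3 : g * r ^ 2 = (g ^ (a - 1) * r ^ a) * (g * r) ^ (2 - a) := by
    rw [mul_rpow hg.le hr.le]
    calc g * r ^ 2 = g ^ ((a - 1) + (2 - a)) * r ^ (a + (2 - a)) := by
          rw [(by ring : (a - 1) + (2 - a) = 1), (by ring : a + (2 - a) = 2), rpow_one, rpow_two]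
      _ = _ := by rw [rpow_add hg, rpow_add hr]; ring
  rw [h3]
  gcongr

theorem rpow_sub_one_le (ha0 : 0 ≤ a) (ha1 : a ≤ 1) (hρ : 0 ≤ ρ) :
    2 ^ (-a) * (ρ ^ (2 - a) - 1) ≤ ρ ^ 2 * (1 + ρ) ^ (-a) := by
  rcases le_total ρ 1 with h | h
  · have h1 : ρ ^ (2 - a) ≤ 1 := rpow_le_one hρ h (by linarith)
    exact (mul_nonpos_of_nonneg_of_nonpos (by positivity) (by linarith)).trans (by positivity)
  · have hρ0 : 0 < ρ := one_pos.trans_le h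
    have h1 : (2 * ρ) ^ (-a) ≤ (1 + ρ) ^ (-a) :=
      rpow_le_rpow_of_nonpos (by positivity) (by linarith) (by linarith)
    rw [mul_rpow (by norm_num) hρ] at h1
    have h2 : ρ ^ (2 - a) = ρ ^ 2 * ρ ^ (-a) := by
      rw [sub_eq_add_neg, rpow_add hρ0, rpow_two]
    calc (2 : ℝ) ^ (-a) * (ρ ^ (2 - a) - 1) ≤ 2 ^ (-a) * ρ ^ (2 - a) := by
          gcongr
          linarith
      _ = ρ ^ 2 * (2 ^ (-a) * ρ ^ (-a)) := by rw [h2]; ring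
      _ ≤ _ := by gcongr

end Scalar

theorem stmt1
    (N : ℕ) (hN : 1 ≤ N)
    (α' : Fin (N + 1) → ℝ) (hα0 : α' 0 = 0) (hαmono : StrictMono α')
    (A : Fin (N + 1) → ℝ) (hA : ∀ i, 0 < A i)
    (k : E3) (hk : ‖k‖ = 1)
    (Rs : ℝ) (hRs : 0 ≤ Rs)
    (X : ℝ → E3 → E3)
    (hX : ∀ z y, gFun N α' A ‖X z y‖ • X z y + (Rs * z) • cross3 k (X z y) = y)
    (a χ₀ c₂ c₃ c₄ c₅ : ℝ)
    (ha : a = α' (Fin.last N) / (1 + α' (Fin.last N)))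
    (hχ₀ : χ₀ = ∑ i, A i)
    (hc₂ : c₂ = 2 ^ a * (min 1 χ₀) ^ (-a) * (min (A 0) (A (Fin.last N)))⁻¹)
    (hc₃ : c₃ = (A (Fin.last N)) ^ (a - 1))
    (hc₄ : c₄ = (min 1 (min (A 0) (A (Fin.last N))) / 2 ^ α' (Fin.last N)) ^ (1 + a))
    (hc₅ : c₅ = 2 ^ (-a) * c₄)
    (z : ℝ) (hz : 0 ≤ z) (y : E3) :
    (c₄ * (χ₀ + Rs * z) ^ (-2 : ℝ) * ‖y‖ ^ (2 : ℝ) * (1 + ‖y‖) ^ (-a)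
        ≤ ⟪X z y, y⟫ ∧
      ⟪X z y, y⟫ ≤ c₂ * (χ₀ + Rs * z) ^ a * ‖y‖ ^ (2 : ℝ) * (1 + ‖y‖) ^ (-a)) ∧
    (c₅ * (χ₀ + Rs * z) ^ (-2 : ℝ) * (‖y‖ ^ (2 - a) - 1) ≤ ⟪X z y, y⟫ ∧
      ⟪X z y, y⟫ ≤ c₃ * ‖y‖ ^ (2 - a)) := by
  have hα : 0 < α' (Fin.last N) := by
    rw [← hα0]
    exact hαmono (Fin.lt_def.2 (by simpa using Nat.pos_of_ne_zero (Nat.one_le_iff_ne_zero.1 hN)))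
  have haα : (1 + α' (Fin.last N)) * a = α' (Fin.last N) := by
    rw [ha]
    field_simp
  have ha0 : 0 ≤ a := by rw [ha]; positivity
  have ha1 : a ≤ 1 := by
    rw [ha, div_le_one (by positivity)]
    linarith
  have hw : 0 ≤ Rs * z := mul_nonneg hRs hz
  have hχ : 0 < χ₀ := by
    rw [hχ₀]
    exact Finset.sum_pos (fun i _ => hA i) Finset.univ_nonempty
  have hb : 0 < min (A 0) (A (Fin.last N)) := lt_min (hA _) (hA _)
  have hr : 0 ≤ ‖X z y‖ := norm_nonneg _
  have hρ : 0 ≤ ‖y‖ := norm_nonneg _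
  have hlow := le_gFun hα0 hA hr
  have hup := gFun_le hα0 hαmono hA hr
  rw [← hχ₀] at hup
  have hinner : ⟪X z y, y⟫ = gFun N α' A ‖X z y‖ * ‖X z y‖ ^ 2 := by
    conv_lhs => rw [← hX z y]
    have := inner_smul_add_cross3 k (X z y) (gFun N α' A ‖X z y‖) (Rs * z)
    rwa [hX z y] at this ⊢
  have hnorm := norm_smul_add_cross3_sq k (X z y) (gFun N α' A ‖X z y‖) (Rs * z)
  rw [hX z y] at hnorm
  have hcross := norm_cross3_sq_le k (X z y)
  rw [hk, one_pow, one_mul] at hcross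
  have hgρ : gFun N α' A ‖X z y‖ * ‖X z y‖ ≤ ‖y‖ := by
    refine (abs_le_of_sq_le_sq' ?_ hρ).2
    rw [hnorm, mul_pow]
    exact le_add_of_nonneg_right (by positivity)
  have hρg : ‖y‖ ^ 2 ≤ (gFun N α' A ‖X z y‖ ^ 2 + (Rs * z) ^ 2) * ‖X z y‖ ^ 2 := by
    rw [hnorm, add_mul]
    gcongr
  have hc₄0 : 0 ≤ c₄ := by rw [hc₄]; positivity
  have hlower := le_mul_sq_of_le_rpow ha0 hα haα hb hχ hw hρ hlow hup hgρ hρg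
  rw [← hc₄] at hlower
  have hS : (χ₀ + Rs * z) ^ (-2 : ℝ) = ((χ₀ + Rs * z) ^ 2)⁻¹ := by
    rw [rpow_neg (by positivity), rpow_two]
  rw [hinner, hS, rpow_two]
  refine ⟨⟨hlower, ?_⟩, ?_, ?_⟩
  · rw [hc₂]
    exact mul_sq_le_of_le_rpow ha0 hα haα hb hχ hw hr hρ hlow hup hgρ hρg
  · refine le_trans ?_ hlower
    rw [hc₅]
    calc 2 ^ (-a) * c₄ * ((χ₀ + Rs * z) ^ 2)⁻¹ * (‖y‖ ^ (2 - a) - 1)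
        = c₄ * ((χ₀ + Rs * z) ^ 2)⁻¹ * (2 ^ (-a) * (‖y‖ ^ (2 - a) - 1)) := by ring
      _ ≤ c₄ * ((χ₀ + Rs * z) ^ 2)⁻¹ * (‖y‖ ^ 2 * (1 + ‖y‖) ^ (-a)) :=
          mul_le_mul_of_nonneg_left (rpow_sub_one_le ha0 ha1 hρ) (by positivity)
      _ = _ := by ring
  · rw [hc₃]
    exact mul_sq_le_rpow ha1 haα (hA _) hr hρ (coeff_mul_rpow_le_gFun hA hr _) hgρ
end
end

section
/- For all z ∈ ℝ and y ∈ ℝ³, the partial derivative of X in z satisfies the formula D_zX(z,y) = −R_* D_yX(z,y) (k × X(z,y)). -/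
open Real

noncomputable section

/-- The Frobenius (Euclidean) norm of the Jacobian matrix of `y ↦ X z y` at `y`. -/
def frobDy (X : ℝ → E3 → E3) (z : ℝ) (y : E3) : ℝ :=
  Real.sqrt (∑ i, ∑ j, (fderiv ℝ (fun y' => X z y') y (EuclideanSpace.single j 1) i) ^ 2)

lemma gFun_pos {N : ℕ} {α' A : Fin (N + 1) → ℝ} (hα0 : α' 0 = 0) (hA : ∀ i, 0 < A i)
    {s : ℝ} (hs : 0 ≤ s) : 0 < gFun N α' A s := by
  unfold gFun
  refine Finset.sum_pos' (fun i _ => mul_nonneg (hA i).le (rpow_nonneg hs _))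
    ⟨0, Finset.mem_univ _, ?_⟩
  simpa [hα0] using hA 0

lemma gFun_monotoneOn {N : ℕ} {α' A : Fin (N + 1) → ℝ} (hα : ∀ i, 0 ≤ α' i)
    (hA : ∀ i, 0 ≤ A i) : MonotoneOn (gFun N α' A) (Set.Ici 0) := fun _ hs _ _ hst =>
  Finset.sum_le_sum fun i _ =>
    mul_le_mul_of_nonneg_left (rpow_le_rpow hs hst (hα i)) (hA i)

lemma inner_cross3_sub (k v w : E3) :
    inner ℝ (cross3 k v - cross3 k w) (v - w) = 0 := by
  simp [cross3, PiLp.inner_apply, Fin.sum_univ_three]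
  ring

/-- A radially nondecreasing positive scaling plus a multiple of `k × ·` is injective. -/
lemma smul_add_smul_cross3_injective {g : ℝ → ℝ} (hpos : ∀ s, 0 ≤ s → 0 < g s)
    (hmono : MonotoneOn g (Set.Ici 0)) (k : E3) (c : ℝ) :
    Function.Injective fun v : E3 => g ‖v‖ • v + c • cross3 k v := by
  intro v w h
  have h_inner : inner ℝ (g ‖v‖ • v - g ‖w‖ • w) (v - w) = 0 := by
    have h' : g ‖v‖ • v - g ‖w‖ • w = -(c • (cross3 k v - cross3 k w)) := by
      rw [smul_sub, neg_sub, sub_eq_sub_iff_add_eq_add, add_comm (c • _)]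
      exact h
    rw [h', inner_neg_left, real_inner_smul_left, inner_cross3_sub, mul_zero, neg_zero]
  have h_expand : inner ℝ (g ‖v‖ • v - g ‖w‖ • w) (v - w)
      = (g ‖v‖ + g ‖w‖) / 2 * ‖v - w‖ ^ 2
        + (g ‖v‖ - g ‖w‖) * (‖v‖ - ‖w‖) * (‖v‖ + ‖w‖) / 2 := by
    rw [norm_sub_sq_real]
    simp only [inner_sub_left, inner_sub_right, real_inner_smul_left,
      real_inner_self_eq_norm_sq, real_inner_comm v w]
    ring
  have h_mono : 0 ≤ (g ‖v‖ - g ‖w‖) * (‖v‖ - ‖w‖) := by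
    rcases le_total ‖v‖ ‖w‖ with hvw | hvw
    · exact mul_nonneg_of_nonpos_of_nonpos
        (sub_nonpos.2 (hmono (norm_nonneg v) (norm_nonneg w) hvw)) (sub_nonpos.2 hvw)
    · exact mul_nonneg
        (sub_nonneg.2 (hmono (norm_nonneg w) (norm_nonneg v) hvw)) (sub_nonneg.2 hvw)
  have h_rest := mul_nonneg h_mono (add_nonneg (norm_nonneg v) (norm_nonneg w))
  have hg : 0 < (g ‖v‖ + g ‖w‖) / 2 :=
    half_pos (add_pos (hpos _ (norm_nonneg v)) (hpos _ (norm_nonneg w)))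
  have h_sq : ‖v - w‖ ^ 2 ≤ 0 := by
    by_contra! hlt
    have := mul_pos hg hlt
    linarith
  exact sub_eq_zero.1 (norm_eq_zero.1 (pow_eq_zero_iff two_ne_zero |>.1
    (le_antisymm h_sq (sq_nonneg _))))

theorem stmt4
    (N : ℕ) (hN : 1 ≤ N)
    (α' : Fin (N + 1) → ℝ) (hα0 : α' 0 = 0) (hαmono : StrictMono α')
    (A : Fin (N + 1) → ℝ) (hA : ∀ i, 0 < A i)
    (k : E3) (hk : ‖k‖ = 1)
    (Rs : ℝ) (hRs : 0 ≤ Rs)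
    (X : ℝ → E3 → E3)
    (hX : ∀ z y, gFun N α' A ‖X z y‖ • X z y + (Rs * z) • cross3 k (X z y) = y)
    (hXC1 : ContDiff ℝ 1 (fun p : ℝ × E3 => X p.1 p.2))
    (z : ℝ) (y : E3) :
    deriv (fun z' => X z' y) z
      = (-Rs) • fderiv ℝ (fun y' => X z y') y (cross3 k (X z y)) := by
  have h_inv : ∀ z' v, X z' (gFun N α' A ‖v‖ • v + (Rs * z') • cross3 k v) = v := fun z' v =>
    smul_add_smul_cross3_injective (fun _ hs => gFun_pos hα0 hA hs)
      (gFun_monotoneOn (fun i => hα0 ▸ hαmono.monotone (Fin.zero_le i)) fun i => (hA i).le)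
      k (Rs * z') (hX z' _)
  set v := X z y
  have hF := (hXC1.differentiable one_ne_zero (z, y)).hasFDerivAt
  set L := fderiv ℝ (fun p : ℝ × E3 => X p.1 p.2) (z, y)
  have hDz : HasDerivAt (fun z' => X z' y) (L (1, 0)) z :=
    hF.comp_hasDerivAt (f := fun z' => (z', y)) z ((hasDerivAt_id z).prodMk (hasDerivAt_const z y))
  have hDy : HasFDerivAt (fun y' => X z y') (L.comp (ContinuousLinearMap.inr ℝ ℝ E3)) y :=
    hF.comp y (hasFDerivAt_prodMk_right z y)
  -- Differentiate the constant curve `z' ↦ X z' (F_{z'} v)`.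
  have h_curve : HasDerivAt
      (fun z' : ℝ => (z', gFun N α' A ‖v‖ • v + (Rs * z') • cross3 k v))
      (1, Rs • cross3 k v) z := by
    refine (hasDerivAt_id z).prodMk ?_
    simpa using (((hasDerivAt_id z).const_mul Rs).smul_const (cross3 k v)).const_add
      (gFun N α' A ‖v‖ • v)
  have h_const : L (1, Rs • cross3 k v) = 0 := by
    have hF' : HasFDerivAt (fun p : ℝ × E3 => X p.1 p.2) L
        (z, gFun N α' A ‖v‖ • v + (Rs * z) • cross3 k v) := by rwa [hX z y]
    refine (hF'.comp_hasDerivAt z h_curve).unique ?_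
    exact (hasDerivAt_const z v).congr_of_eventuallyEq (.of_forall fun z' => h_inv z' v)
  have h_split : ((1, Rs • cross3 k v) : ℝ × E3) = (1, 0) + Rs • (0, cross3 k v) := by simp
  rw [h_split, map_add, map_smul] at h_const
  rw [hDz.deriv, hDy.fderiv, neg_smul]
  exact eq_neg_of_add_eq_zero_left h_const
end
end
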